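/- Let G be a group, N a normal subgroup of G, and let π₁, π₂ be irreducible finite-dimensional complex representations of G. If Hom_N(π₁, π₂) ≠ 0, then (dim Hom_N(π₁, π₂))² = dim Hom_N(π₁, π₁) · dim Hom_N(π₂, π₂). -/

import Mathlib

variable {G : Type*} [Group G]

/-- A finite-dimensional complex representation is irreducible if it is nonzero and has no
invariant subspace other than `⊥` and `⊤`. -/
def IsIrrep {V : Type*} [AddCommGroup V] [Module ℂ V] (ρ : Representation ℂ G V) : Prop :=
  Nontrivial V ∧ ∀ p : Submodule ℂ V, (∀ g : G, ∀ v ∈ p, ρ g v ∈ p) → p = ⊥ ∨ p = ⊤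

/-- The space of linear maps intertwining the restrictions to a subgroup `H`. -/
def homSpace (H : Subgroup G) {V₁ V₂ : Type*} [AddCommGroup V₁] [Module ℂ V₁]
    [AddCommGroup V₂] [Module ℂ V₂] (ρ₁ : Representation ℂ G V₁)
    (ρ₂ : Representation ℂ G V₂) : Submodule ℂ (V₁ →ₗ[ℂ] V₂) where
  carrier := {f | ∀ h ∈ H, ∀ v, f (ρ₁ h v) = ρ₂ h (f v)}
  add_mem' := by
    intro f g hf hg h hh v
    simp [hf h hh v, hg h hh v]
  zero_mem' := by intro h hh v; simp
  smul_mem' := by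
    intro c f hf h hh v
    simp [hf h hh v]

section HomDimension

variable (k : Type*) {A : Type*} [Field k] [Ring A] [Algebra k A]
variable {M Y X : Type*} [AddCommGroup M] [Module A M] [AddCommGroup Y] [Module A Y]
  [AddCommGroup X] [Module A X]

section

variable [Module k X] [IsScalarTower k A X]

/-- Isomorphic modules admit homomorphism spaces of equal dimension into a third module. -/
theorem finrank_linearMap_congr_left (e : M ≃ₗ[A] Y) :
    Module.finrank k (M →ₗ[A] X) = Module.finrank k (Y →ₗ[A] X) :=
  (e.congrLeft X k).finrank_eq

/-- Twisting source and target by the same ring automorphism preserves the dimension of the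
homomorphism space. -/
theorem finrank_linearMap_eq_of_semilinear {σ σinv : A →+* A} [RingHomInvPair σ σinv]
    [RingHomInvPair σinv σ] (e : M ≃ₛₗ[σ] Y) (f : X ≃ₛₗ[σ] X)
    (hf : ∀ (c : k) (x : X), f (c • x) = c • f x) :
    Module.finrank k (M →ₗ[A] X) = Module.finrank k (Y →ₗ[A] X) :=
  LinearEquiv.finrank_eq
    { e.arrowCongrAddEquiv f with
      map_smul' := fun c g ↦ by
        ext x
        exact hf c (g (e.symm x)) }

end

variable [Module k M] [IsScalarTower k A M]

section

variable [Module k Y] [IsScalarTower k A Y]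

/-- Isomorphic modules admit homomorphism spaces of equal dimension from a third module. -/
theorem finrank_linearMap_congr_right (e : M ≃ₗ[A] Y) :
    Module.finrank k (X →ₗ[A] M) = Module.finrank k (X →ₗ[A] Y) :=
  LinearEquiv.finrank_eq
    { (LinearEquiv.refl A X).arrowCongrAddEquiv e with
      map_smul' := fun c f ↦ by
        ext x
        exact LinearMap.map_smul_of_tower e.toLinearMap c (f x) }

end

variable [Module k X] [IsScalarTower k A X]

/-- The space of `A`-linear maps between finite-dimensional modules over a `k`-algebra `A` is
finite-dimensional. -/
theorem finiteDimensional_linearMap_of_algebra [FiniteDimensional k M] [FiniteDimensional k X] :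
    FiniteDimensional k (M →ₗ[A] X) :=
  Module.Finite.of_injective (LinearMap.restrictScalarsₗ k A M X k)
    (LinearMap.restrictScalars_injective k)

/-- Homomorphisms out of a finite direct sum have additive dimension. -/
theorem finrank_linearMap_dfinsupp_left [FiniteDimensional k M] [FiniteDimensional k X] {n : ℕ}
    (S : Fin n → Submodule A M) :
    Module.finrank k ((Π₀ i, S i) →ₗ[A] X) = ∑ i, Module.finrank k (S i →ₗ[A] X) := by
  have (i : Fin n) : FiniteDimensional k (S i) :=
    inferInstanceAs (FiniteDimensional k ((S i).restrictScalars k))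
  have (i : Fin n) := finiteDimensional_linearMap_of_algebra k (A := A) (M := S i) (X := X)
  rw [← (DFinsupp.lsum k (R := A) (M := fun i ↦ S i) (N := X)).finrank_eq,
    Module.finrank_pi_fintype]

/-- Homomorphisms into a finite direct sum have additive dimension. -/
theorem finrank_linearMap_dfinsupp_right [FiniteDimensional k M] [FiniteDimensional k X] {n : ℕ}
    (S : Fin n → Submodule A M) :
    Module.finrank k (X →ₗ[A] Π₀ i, S i) = ∑ i, Module.finrank k (X →ₗ[A] S i) := by
  have (i : Fin n) : FiniteDimensional k (S i) :=
    inferInstanceAs (FiniteDimensional k ((S i).restrictScalars k))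
  have (i : Fin n) := finiteDimensional_linearMap_of_algebra k (A := A) (M := X) (X := S i)
  rw [finrank_linearMap_congr_right k (DFinsupp.linearEquivFunOnFintype (R := A)),
    ← (LinearEquiv.linearMapPi (R := A) (M₂ := X) (φ := fun i ↦ S i) k).finrank_eq,
    Module.finrank_pi_fintype]

/-- If `M` is a direct sum of `n` submodules, each with a `c`-dimensional space of homomorphisms
to `X`, then `Hom(M, X)` has dimension `n * c`. -/
theorem finrank_linearMap_eq_mul [FiniteDimensional k M] [FiniteDimensional k X] {n c : ℕ}
    {S : Fin n → Submodule A M} (e : M ≃ₗ[A] Π₀ i, S i)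
    (hc : ∀ i, Module.finrank k (S i →ₗ[A] X) = c) :
    Module.finrank k (M →ₗ[A] X) = n * c := by
  rw [finrank_linearMap_congr_left k e, finrank_linearMap_dfinsupp_left,
    Finset.sum_congr rfl fun i _ ↦ hc i]
  simp

variable [Module k Y] [IsScalarTower k A Y]

/-- The dimension of the space of homomorphisms between simple modules is symmetric. -/
theorem IsSimpleModule.finrank_linearMap_comm [IsSimpleModule A M] [IsSimpleModule A Y] :
    Module.finrank k (M →ₗ[A] Y) = Module.finrank k (Y →ₗ[A] M) := by
  by_cases h : Nonempty (M ≃ₗ[A] Y)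
  · obtain ⟨e⟩ := h
    rw [finrank_linearMap_congr_left k e, finrank_linearMap_congr_right k e]
  · have h₁ (f : M →ₗ[A] Y) : f = 0 :=
      f.bijective_or_eq_zero.resolve_left fun hf ↦ h ⟨.ofBijective f hf⟩
    have h₂ (f : Y →ₗ[A] M) : f = 0 :=
      f.bijective_or_eq_zero.resolve_left fun hf ↦ h ⟨(LinearEquiv.ofBijective f hf).symm⟩
    have : Subsingleton (M →ₗ[A] Y) := ⟨fun f g ↦ by rw [h₁ f, h₁ g]⟩
    have : Subsingleton (Y →ₗ[A] M) := ⟨fun f g ↦ by rw [h₂ f, h₂ g]⟩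
    rw [Module.finrank_zero_of_subsingleton, Module.finrank_zero_of_subsingleton]

/-- The dimension of the space of homomorphisms between finite-dimensional semisimple modules is
symmetric. -/
theorem IsSemisimpleModule.finrank_linearMap_comm [FiniteDimensional k M] [FiniteDimensional k Y]
    [IsSemisimpleModule A M] [IsSemisimpleModule A Y] :
    Module.finrank k (M →ₗ[A] Y) = Module.finrank k (Y →ₗ[A] M) := by
  have := Module.Finite.of_restrictScalars_finite k A M
  have := Module.Finite.of_restrictScalars_finite k A Y
  obtain ⟨n, S, e, hS⟩ := IsSemisimpleModule.exists_linearEquiv_fin_dfinsupp A M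
  obtain ⟨m, T, t, hT⟩ := IsSemisimpleModule.exists_linearEquiv_fin_dfinsupp A Y
  have (i : Fin n) : FiniteDimensional k (S i) :=
    inferInstanceAs (FiniteDimensional k ((S i).restrictScalars k))
  rw [finrank_linearMap_congr_left k e, finrank_linearMap_congr_right k e,
    finrank_linearMap_dfinsupp_left, finrank_linearMap_dfinsupp_right]
  refine Finset.sum_congr rfl fun i _ ↦ ?_
  rw [finrank_linearMap_congr_left k t, finrank_linearMap_congr_right k t,
    finrank_linearMap_dfinsupp_left, finrank_linearMap_dfinsupp_right]
  exact Finset.sum_congr rfl fun j _ ↦ IsSimpleModule.finrank_linearMap_comm k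

end HomDimension

section Clifford

variable {A M ι : Type*} [Ring A] [AddCommGroup M] [Module A M]
  {σ σinv : ι → A →+* A} [∀ g, RingHomInvPair (σ g) (σinv g)] [∀ g, RingHomInvPair (σinv g) (σ g)]

/-- The image of a simple submodule under a semilinear automorphism is simple. -/
theorem IsSimpleModule.map_semilinearEquiv {τ τinv : A →+* A} [RingHomInvPair τ τinv]
    [RingHomInvPair τinv τ] (e : M ≃ₛₗ[τ] M) (S : Submodule A M) [IsSimpleModule A S] :
    IsSimpleModule A (S.map (e : M →ₛₗ[τ] M)) :=
  ((e.submoduleMap S : S →ₛₗ[τ] _).isSimpleModule_iff_of_bijective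
    (e.submoduleMap S).bijective).mp ‹_›

/-- A module spanned by semilinear translates of a simple submodule is semisimple. -/
theorem isSemisimpleModule_of_iSup_map_eq_top (e : ∀ g, M ≃ₛₗ[σ g] M) (S : Submodule A M)
    [IsSimpleModule A S] (h : ⨆ g, S.map (e g : M →ₛₗ[σ g] M) = ⊤) : IsSemisimpleModule A M :=
  isSemisimpleModule_of_isSemisimpleModule_submodule'
    (fun g ↦ have := IsSimpleModule.map_semilinearEquiv (e g) S; inferInstance) h

/-- A nonzero finite-dimensional module in which every nonzero submodule has spanning semilinear
translates is semisimple. -/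
theorem isSemisimpleModule_of_forall_iSup_map_eq_top (k : Type*) [Field k] [Algebra k A]
    [Module k M] [IsScalarTower k A M] [FiniteDimensional k M] [Nontrivial M]
    (e : ∀ g, M ≃ₛₗ[σ g] M)
    (h : ∀ S : Submodule A M, S ≠ ⊥ → ⨆ g, S.map (e g : M →ₛₗ[σ g] M) = ⊤) :
    IsSemisimpleModule A M := by
  have : IsArtinian A M := isArtinian_of_tower k inferInstance
  obtain ⟨S, hS⟩ := IsAtomic.exists_atom (Submodule A M)
  have := isSimpleModule_iff_isAtom.mpr hS
  exact isSemisimpleModule_of_iSup_map_eq_top e S (h S hS.1)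

/-- If `M` is spanned by semilinear translates of a simple submodule `S`, then all simple
submodules of `M` have homomorphism spaces to `X` of the same dimension as `S`, provided the
twists lift to `X`. -/
theorem finrank_linearMap_eq_of_iSup_map_eq_top (k : Type*) [Field k] [Algebra k A] [Module k M]
    [IsScalarTower k A M] {X : Type*} [AddCommGroup X] [Module k X] [Module A X]
    [IsScalarTower k A X] (e : ∀ g, M ≃ₛₗ[σ g] M) (f : ∀ g, X ≃ₛₗ[σ g] X)
    (hf : ∀ g (c : k) (x : X), f g (c • x) = c • f g x) (S : Submodule A M)
    [IsSimpleModule A S] (h : ⨆ g, S.map (e g : M →ₛₗ[σ g] M) = ⊤)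
    (T : Submodule A M) [IsSimpleModule A T] :
    Module.finrank k (T →ₗ[A] X) = Module.finrank k (S →ₗ[A] X) := by
  have : ∀ m : Set.range fun g ↦ S.map (e g : M →ₛₗ[σ g] M), IsSimpleModule A m := by
    rintro ⟨_, g, rfl⟩
    exact IsSimpleModule.map_semilinearEquiv (e g) S
  obtain ⟨_, ⟨g, rfl⟩, ⟨t⟩⟩ := T.linearEquiv_of_sSup_eq_top _ h
  rw [finrank_linearMap_congr_left k t,
    finrank_linearMap_eq_of_semilinear k ((e g).submoduleMap S) (f g) (hf g)]

/-- Let `M₁` and `M₂` be finite-dimensional modules with a common family of semilinear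
automorphisms such that every nonzero submodule of either has spanning translates. If
`Hom(M₁, M₂) ≠ 0`, then `(dim Hom(M₁, M₂))² = dim End M₁ * dim End M₂`. -/
theorem finrank_linearMap_sq_of_iSup_map_eq_top (k : Type*) [Field k] [Algebra k A]
    {M₁ M₂ : Type*}
    [AddCommGroup M₁] [Module k M₁] [Module A M₁] [IsScalarTower k A M₁] [FiniteDimensional k M₁]
    [AddCommGroup M₂] [Module k M₂] [Module A M₂] [IsScalarTower k A M₂] [FiniteDimensional k M₂]
    (e₁ : ∀ g, M₁ ≃ₛₗ[σ g] M₁) (e₂ : ∀ g, M₂ ≃ₛₗ[σ g] M₂)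
    (hk₁ : ∀ g (c : k) x, e₁ g (c • x) = c • e₁ g x)
    (hk₂ : ∀ g (c : k) x, e₂ g (c • x) = c • e₂ g x)
    (h₁ : ∀ S : Submodule A M₁, S ≠ ⊥ → ⨆ g, S.map (e₁ g : M₁ →ₛₗ[σ g] M₁) = ⊤)
    (h₂ : ∀ S : Submodule A M₂, S ≠ ⊥ → ⨆ g, S.map (e₂ g : M₂ →ₛₗ[σ g] M₂) = ⊤)
    {φ : M₁ →ₗ[A] M₂} (hφ : φ ≠ 0) :
    Module.finrank k (M₁ →ₗ[A] M₂) ^ 2 =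
      Module.finrank k (M₁ →ₗ[A] M₁) * Module.finrank k (M₂ →ₗ[A] M₂) := by
  obtain ⟨x, hx⟩ := DFunLike.ne_iff.mp hφ
  have : Nontrivial M₁ := ⟨x, 0, fun h ↦ hx (by simp [h])⟩
  have : Nontrivial M₂ := ⟨φ x, 0, hx⟩
  have := isSemisimpleModule_of_forall_iSup_map_eq_top k e₁ h₁
  have := isSemisimpleModule_of_forall_iSup_map_eq_top k e₂ h₂
  obtain ⟨S₁, hS₁ : IsSimpleModule A S₁, ne⟩ := LinearMap.exists_ne_zero_of_sSup_eq_top hφ _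
    (IsSemisimpleModule.sSup_simples_eq_top A M₁)
  let S₂ := LinearMap.range (φ ∘ₗ S₁.subtype)
  let s : S₁ ≃ₗ[A] S₂ := .ofInjective _ (LinearMap.injective_of_ne_zero ne)
  have : IsSimpleModule A S₂ := .congr s.symm
  have span₁ := h₁ S₁ (isSimpleModule_iff_isAtom.mp hS₁).1
  have span₂ := h₂ S₂ (isSimpleModule_iff_isAtom.mp this).1
  have := Module.Finite.of_restrictScalars_finite k A M₁
  have := Module.Finite.of_restrictScalars_finite k A M₂
  obtain ⟨n₁, T₁, t₁, hT₁⟩ := IsSemisimpleModule.exists_linearEquiv_fin_dfinsupp A M₁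
  obtain ⟨n₂, T₂, t₂, hT₂⟩ := IsSemisimpleModule.exists_linearEquiv_fin_dfinsupp A M₂
  have h₁₁ := finrank_linearMap_eq_mul k t₁ fun i ↦
    finrank_linearMap_eq_of_iSup_map_eq_top k e₁ e₁ hk₁ S₁ span₁ (T₁ i)
  have h₁₂ := finrank_linearMap_eq_mul k t₁ fun i ↦
    finrank_linearMap_eq_of_iSup_map_eq_top k e₁ e₂ hk₂ S₁ span₁ (T₁ i)
  have h₂₁ := finrank_linearMap_eq_mul k t₂ fun i ↦
    finrank_linearMap_eq_of_iSup_map_eq_top k e₂ e₁ hk₁ S₂ span₂ (T₂ i)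
  have h₂₂ := finrank_linearMap_eq_mul k t₂ fun i ↦
    finrank_linearMap_eq_of_iSup_map_eq_top k e₂ e₂ hk₂ S₂ span₂ (T₂ i)
  rw [← finrank_linearMap_congr_left k s] at h₂₁ h₂₂
  rw [sq]
  nth_rw 2 [IsSemisimpleModule.finrank_linearMap_comm k]
  rw [h₁₁, h₁₂, h₂₁, h₂₂]
  ring

end Clifford

section Restriction

variable {V : Type*} [AddCommGroup V] [Module ℂ V] (N : Subgroup G)

/-- The restriction of a representation to a subgroup. -/
abbrev resRep (ρ : Representation ℂ G V) : Representation ℂ N V :=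
  ρ.comp N.subtype

/-- The restriction of a representation to a subgroup, as a module over the group algebra. -/
abbrev resModule (ρ : Representation ℂ G V) : Type _ :=
  (resRep N ρ).asModule

/-- Intertwining maps over a subgroup are linear maps over its group algebra. -/
noncomputable def homSpaceEquiv {W : Type*} [AddCommGroup W] [Module ℂ W]
    (ρ : Representation ℂ G V) (τ : Representation ℂ G W) :
    homSpace N ρ τ ≃ₗ[ℂ] (resModule N ρ →ₗ[MonoidAlgebra ℂ N] resModule N τ) :=
  LinearEquiv.trans
    { toFun := fun f ↦ (⟨f.1, fun n ↦ LinearMap.ext fun v ↦ f.2 n n.2 v⟩ :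
        Representation.IntertwiningMap (resRep N ρ) (resRep N τ))
      invFun := fun f ↦ ⟨f.toLinearMap, fun n hn v ↦
        LinearMap.congr_fun (f.isIntertwining' ⟨n, hn⟩) v⟩
      map_add' := fun _ _ ↦ rfl
      map_smul' := fun _ _ ↦ rfl
      left_inv := fun _ ↦ rfl
      right_inv := fun _ ↦ rfl }
    (Representation.IntertwiningMap.equivLinearMapAsModule _ _)

variable [N.Normal]

/-- The automorphism of the group algebra of a normal subgroup induced by conjugation. -/
noncomputable abbrev conjGroupAlgebra (g : G) : MonoidAlgebra ℂ N →+* MonoidAlgebra ℂ N :=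
  MonoidAlgebra.mapDomainRingHom ℂ (MulAut.conjNormal g : MulAut N)

instance (g : G) : RingHomInvPair (conjGroupAlgebra N g) (conjGroupAlgebra N g⁻¹) where
  comp_eq := by apply MonoidAlgebra.ringHom_ext <;> simp [conjGroupAlgebra]
  comp_eq₂ := by apply MonoidAlgebra.ringHom_ext <;> simp [conjGroupAlgebra]

instance (g : G) : RingHomInvPair (conjGroupAlgebra N g⁻¹) (conjGroupAlgebra N g) :=
  .symm _ _

/-- The action of `g` on the restriction of a representation to a normal subgroup, semilinear over
conjugation by `g`. -/
noncomputable def resModuleTranslate (ρ : Representation ℂ G V) (g : G) :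
    resModule N ρ ≃ₛₗ[conjGroupAlgebra N g] resModule N ρ where
  toFun v := (resRep N ρ).asModuleEquiv.symm (ρ g ((resRep N ρ).asModuleEquiv v))
  invFun v := (resRep N ρ).asModuleEquiv.symm (ρ g⁻¹ ((resRep N ρ).asModuleEquiv v))
  map_add' := by simp
  map_smul' a v := by
    induction a using MonoidAlgebra.induction_linear with
    | zero => simp
    | add x y hx hy => simp only [add_smul, map_add, hx, hy]
    | single n c =>
      simp [Representation.single_smul, conjGroupAlgebra]
      exact map_smul (ρ g) c (ρ n ((resRep N ρ).asModuleEquiv v))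
  left_inv v := by simp
  right_inv v := by simp

/-- The translates of a nonzero subspace stable under a normal subgroup span an irreducible
representation. -/
theorem IsIrrep.iSup_map_resModuleTranslate_eq_top {ρ : Representation ℂ G V} (h : IsIrrep ρ)
    (S : Submodule (MonoidAlgebra ℂ N) (resModule N ρ)) (hS : S ≠ ⊥) :
    ⨆ g, S.map (resModuleTranslate N ρ g).toLinearMap = ⊤ := by
  set P := ⨆ g, S.map (resModuleTranslate N ρ g).toLinearMap
  have le (g : G) : S.map (resModuleTranslate N ρ g).toLinearMap ≤ P :=
    le_iSup (fun g ↦ S.map (resModuleTranslate N ρ g).toLinearMap) g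
  have stable (g : G) : P ≤ P.comap (resModuleTranslate N ρ g).toLinearMap := by
    refine iSup_le fun x ↦ ?_
    rintro _ ⟨v, hv, rfl⟩
    refine le (g * x) ⟨v, hv, ?_⟩
    exact LinearMap.congr_fun (map_mul ρ g x) v
  have key := h.2 ((P.restrictScalars ℂ).map (resRep N ρ).asModuleEquiv.toLinearMap) (by
    rintro g _ ⟨v, hv, rfl⟩
    exact ⟨_, stable g hv, rfl⟩)
  rw [Submodule.map_eq_bot_iff, Submodule.map_eq_top_iff] at key
  obtain ⟨v, hv, hv0⟩ := S.ne_bot_iff.mp hS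
  have hvP : v ∈ P := le 1 ⟨v, hv, LinearMap.congr_fun (map_one ρ) v⟩
  rcases key with key | key
  · rw [Submodule.restrictScalars_eq_bot_iff] at key
    exact absurd ((Submodule.mem_bot _).mp (key ▸ hvP)) hv0
  · rwa [Submodule.restrictScalars_eq_top_iff] at key

end Restriction

/-- if `Hom_N(π₁, π₂) ≠ 0` then
`(dim Hom_N(π₁, π₂))² = dim Hom_N(π₁, π₁) · dim Hom_N(π₂, π₂)`. -/
theorem stmt5 {V₁ V₂ : Type*} [AddCommGroup V₁] [Module ℂ V₁] [FiniteDimensional ℂ V₁]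
    [AddCommGroup V₂] [Module ℂ V₂] [FiniteDimensional ℂ V₂]
    (N : Subgroup G) [N.Normal]
    (ρ₁ : Representation ℂ G V₁) (ρ₂ : Representation ℂ G V₂)
    (h₁ : IsIrrep ρ₁) (h₂ : IsIrrep ρ₂)
    (hne : homSpace N ρ₁ ρ₂ ≠ ⊥) :
    Module.finrank ℂ (homSpace N ρ₁ ρ₂) ^ 2 =
      Module.finrank ℂ (homSpace N ρ₁ ρ₁) * Module.finrank ℂ (homSpace N ρ₂ ρ₂) := by
  obtain ⟨f, hf, hf0⟩ := (homSpace N ρ₁ ρ₂).ne_bot_iff.mp hne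
  rw [(homSpaceEquiv N ρ₁ ρ₂).finrank_eq, (homSpaceEquiv N ρ₁ ρ₁).finrank_eq,
    (homSpaceEquiv N ρ₂ ρ₂).finrank_eq]
  exact finrank_linearMap_sq_of_iSup_map_eq_top ℂ
    (resModuleTranslate N ρ₁) (resModuleTranslate N ρ₂)
    (fun g ↦ map_smul (ρ₁ g)) (fun g ↦ map_smul (ρ₂ g))
    (h₁.iSup_map_resModuleTranslate_eq_top N) (h₂.iSup_map_resModuleTranslate_eq_top N)
    (φ := homSpaceEquiv N ρ₁ ρ₂ ⟨f, hf⟩)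
    ((homSpaceEquiv N ρ₁ ρ₂).map_ne_zero_iff.mpr fun h ↦ hf0 (congrArg Subtype.val h))
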